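/- arXiv:2304.03876 — 2 statements merged into one kernel-verified Lean document; each statement's English description precedes it below -/
import Mathlib

section
/- Let (X,d) be a metric space and let U ⊆ F¹_USCG(X). Then U is relatively compact in the metric space (F¹_USCG(X), H_end) if and only if U(α) = ∪_{u∈U} [u]_α is relatively compact in (X,d) for each α ∈ (0,1]. -/
open Set Filter Topology MeasureTheory
open scoped ENNReal NNReal

noncomputable section

/-- `sup_{a ∈ A} inf_{b ∈ B} ρ a b`, valued in `ℝ≥0∞`. -/
def hStar {Y : Type*} (ρ : Y → Y → ℝ≥0∞) (A B : Set Y) : ℝ≥0∞ :=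
  ⨆ a ∈ A, ⨅ b ∈ B, ρ a b

/-- Hausdorff (extended) distance with respect to the distance `ρ`:
`H(A,B) = max (H*(A,B)) (H*(B,A))`. -/
def hDist {Y : Type*} (ρ : Y → Y → ℝ≥0∞) (A B : Set Y) : ℝ≥0∞ :=
  max (hStar ρ A B) (hStar ρ B A)

/-- Kuratowski lower limit of a sequence of sets. -/
def KurLiminf {Y : Type*} [TopologicalSpace Y] (C : ℕ → Set Y) : Set Y :=
  {y | ∃ f : ℕ → Y, (∀ n, f n ∈ C n) ∧ Tendsto f atTop (𝓝 y)}

/-- Kuratowski upper limit of a sequence of sets. -/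
def KurLimsup {Y : Type*} [TopologicalSpace Y] (C : ℕ → Set Y) : Set Y :=
  {y | ∃ φ : ℕ → ℕ, StrictMono φ ∧ ∃ f : ℕ → Y,
      (∀ k, f k ∈ C (φ k)) ∧ Tendsto f atTop (𝓝 y)}

/-- Kuratowski convergence of a sequence of sets to a set. -/
def KurConv {Y : Type*} [TopologicalSpace Y] (C : ℕ → Set Y) (L : Set Y) : Prop :=
  KurLiminf C = L ∧ KurLimsup C = L

/-- A set `P` is dense in the set `S` (in particular `P ⊆ S`). -/
def DenseIn {Y : Type*} [TopologicalSpace Y] (P S : Set Y) : Prop :=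
  P ⊆ S ∧ S ⊆ closure P

variable {X : Type*} [MetricSpace X]

/-- Hausdorff distance `H*` between subsets of the metric space `X`. -/
def HXstar (A B : Set X) : ℝ≥0∞ := hStar edist A B

/-- Hausdorff distance `H` between subsets of the metric space `X`. -/
def HXdist (A B : Set X) : ℝ≥0∞ := hDist edist A B

/-- The metric `d̄` on `X × [0,1]` (modelled on `X × ℝ`):
`d̄((x,α),(y,β)) = d(x,y) + |α - β|`. -/
def dbar (p q : X × ℝ) : ℝ≥0∞ := edist p.1 q.1 + edist p.2 q.2

/-- `H*` for subsets of `(X × [0,1], d̄)`. -/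
def HPstar (A B : Set (X × ℝ)) : ℝ≥0∞ := hStar dbar A B

/-- Hausdorff distance for subsets of `(X × [0,1], d̄)`. -/
def HPdist (A B : Set (X × ℝ)) : ℝ≥0∞ := hDist dbar A B

/-- The α-cut of a fuzzy set `u : X → ℝ`:  `[u]_α = {x | u x ≥ α}` for `α ≠ 0`, and
`[u]_0 = closure {x | u x > 0}`. -/
def acut (u : X → ℝ) (α : ℝ) : Set X :=
  if α = 0 then closure {x | 0 < u x} else {x | α ≤ u x}

/-- The endograph of `u`: `{(x,t) ∈ X × [0,1] : u x ≥ t}`. -/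
def endograph (u : X → ℝ) : Set (X × ℝ) :=
  {p : X × ℝ | p.2 ∈ Icc (0:ℝ) 1 ∧ p.2 ≤ u p.1}

/-- The sendograph of `u`: `end u ∩ ([u]_0 × [0,1])`. -/
def sendograph (u : X → ℝ) : Set (X × ℝ) :=
  endograph u ∩ ((acut u 0) ×ˢ (Icc (0:ℝ) 1))

/-- `F¹_USC(X)`: normal upper semicontinuous fuzzy sets with values in `[0,1]`, i.e. all
α-cuts (`α ∈ [0,1]`) are nonempty and closed. -/
def FUSC (u : X → ℝ) : Prop :=
  (∀ x, u x ∈ Icc (0:ℝ) 1) ∧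
    ∀ α ∈ Icc (0:ℝ) 1, (acut u α).Nonempty ∧ IsClosed (acut u α)

/-- `F¹_USCG(X)`: members of `F¹_USC(X)` whose α-cuts are compact for `α ∈ (0,1]`. -/
def FUSCG (u : X → ℝ) : Prop :=
  FUSC u ∧ ∀ α ∈ Ioc (0:ℝ) 1, IsCompact (acut u α)

/-- `F¹_USCB(X)`: members of `F¹_USC(X)` whose 0-cut is compact. -/
def FUSCB (u : X → ℝ) : Prop :=
  FUSC u ∧ IsCompact (acut u 0)

/-- The endograph metric `H_end`. -/
def Hend (u v : X → ℝ) : ℝ≥0∞ := HPdist (endograph u) (endograph v)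

/-- The sendograph metric `H_send`. -/
def Hsend (u v : X → ℝ) : ℝ≥0∞ := HPdist (sendograph u) (sendograph v)

/-- Γ-convergence: Kuratowski convergence of the endographs in `X × [0,1]`. -/
def GammaConv (un : ℕ → X → ℝ) (u : X → ℝ) : Prop :=
  KurConv (fun n => endograph (un n)) (endograph u)

/-- `P(u)`: the set of `α ∈ (0,1)` such that `closure {u > α}` is a proper subset of `[u]_α`. -/
def Pset (u : X → ℝ) : Set ℝ :=
  {α ∈ Ioo (0:ℝ) 1 | closure {x | α < u x} ⊂ acut u α}

/-- `D(u)`: the set of `α ∈ (0,1)` such that `[u]_α ⊄ closure {u > α}`. -/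
def Dset (u : X → ℝ) : Set ℝ :=
  {α ∈ Ioo (0:ℝ) 1 | ¬ acut u α ⊆ closure {x | α < u x}}

/-- `P₀(u) = (0,1) \ {α ∈ (0,1) : lim_{β → α} H([u]_β , [u]_α) = 0}`. -/
def P0set (u : X → ℝ) : Set ℝ :=
  Ioo (0:ℝ) 1 \
    {α | Tendsto (fun β => HXdist (acut u β) (acut u α)) (𝓝[Icc (0:ℝ) 1] α) (𝓝 0)}

/-- The `d_p^*` distance on fuzzy sets. -/
def dpstar (p : ℝ) (u v : X → ℝ) : ℝ≥0∞ :=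
  ⨅ f ∈ {f : ℝ → ℝ≥0∞ | Measurable f ∧
      ∀ α ∈ Icc (0:ℝ) 1, HXdist (acut u α) (acut v α) ≤ f α},
    (∫⁻ α in Icc (0:ℝ) 1, f α ^ p) ^ (1 / p)


/-- A bound for one half of the endograph distance, in terms of pointwise approximation. -/
theorem HPstar_endograph_le {u v : X → ℝ} {ε : ℝ} (hε : 0 < ε) (hv : ∀ x, 0 ≤ v x)
    (h : ∀ x t, ε ≤ t → t ≤ 1 → t ≤ u x → ∃ y, dist x y ≤ ε ∧ t - ε ≤ v y) :
    HPstar (endograph u) (endograph v) ≤ ENNReal.ofReal (2 * ε) := by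
  refine iSup₂_le ?_
  rintro ⟨x, t⟩ ⟨⟨ht0, ht1⟩, htu⟩
  have key : ∃ y r, (y, r) ∈ endograph v ∧ dist x y + dist t r ≤ 2 * ε := by
    by_cases hte : ε ≤ t
    · obtain ⟨y, hy, hty⟩ := h x t hte ht1 htu
      refine ⟨y, t - ε, ⟨⟨?_, ?_⟩, hty⟩, ?_⟩
      · simpa using hte
      · simp only at ht1 ⊢; linarith
      · rw [Real.dist_eq, sub_sub_cancel, abs_of_pos hε]; linarith
    · simp only at ht0
      refine ⟨x, 0, ⟨⟨le_rfl, zero_le_one⟩, hv x⟩, ?_⟩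
      rw [dist_self, Real.dist_eq, sub_zero, abs_of_nonneg ht0]; linarith
  obtain ⟨y, r, hyr, hd⟩ := key
  refine iInf₂_le_of_le (y, r) hyr ?_
  simp only [dbar, edist_dist]
  rw [← ENNReal.ofReal_add dist_nonneg dist_nonneg]
  exact ENNReal.ofReal_le_ofReal hd

theorem exists_near_of_Hend_lt {u v : X → ℝ} {ε : ℝ} (h : Hend u v < ENNReal.ofReal ε)
    {x : X} {t : ℝ} (ht0 : 0 ≤ t) (ht1 : t ≤ 1) (ht : t ≤ u x) :
    ∃ y, dist x y < ε ∧ t - ε < v y := by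
  have h1 : (⨅ q ∈ endograph v, dbar (x, t) q) < ENNReal.ofReal ε := by
    refine lt_of_le_of_lt ?_ (lt_of_le_of_lt (le_max_left _ _) h)
    exact le_iSup₂_of_le (f := fun p (_ : p ∈ endograph u) => ⨅ q ∈ endograph v, dbar p q)
      (x, t) ⟨⟨ht0, ht1⟩, ht⟩ le_rfl
  simp only [iInf_lt_iff] at h1
  obtain ⟨⟨y, r⟩, ⟨-, hr⟩, hlt⟩ := h1
  simp only [dbar, edist_dist] at hlt hr
  rw [← ENNReal.ofReal_add dist_nonneg dist_nonneg, ENNReal.ofReal_lt_ofReal_iff'] at hlt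
  have h2 := le_abs_self (t - r)
  rw [← Real.dist_eq] at h2
  have h3 : 0 ≤ dist t r := dist_nonneg
  have h4 : 0 ≤ dist x y := dist_nonneg
  exact ⟨y, by linarith [hlt.1], by linarith [hlt.1]⟩

/-- Sequential criterion for relative compactness in a metric space. -/
theorem isCompact_closure_of_tendsto_subseq {S : Set X}
    (h : ∀ x : ℕ → X, (∀ n, x n ∈ S) →
      ∃ a, ∃ φ : ℕ → ℕ, StrictMono φ ∧ Tendsto (x ∘ φ) atTop (𝓝 a)) :
    IsCompact (closure S) := by
  refine IsSeqCompact.isCompact ?_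
  intro y hy
  have hex : ∀ n : ℕ, ∃ x ∈ S, dist (y n) x < 1 / ((n : ℝ) + 1) := fun n =>
    Metric.mem_closure_iff.1 (hy n) _ Nat.one_div_pos_of_nat
  choose x hxS hxy using hex
  obtain ⟨a, φ, hφ, hlim⟩ := h x hxS
  refine ⟨a, ?_, φ, hφ, ?_⟩
  · exact mem_closure_of_tendsto hlim (Eventually.of_forall fun n => hxS _)
  · have h0 : Tendsto (fun n => dist ((x ∘ φ) n) ((y ∘ φ) n)) atTop (𝓝 0) := by
      refine squeeze_zero (fun _ => dist_nonneg) (fun n => ?_)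
        (tendsto_one_div_add_atTop_nhds_zero_nat.comp hφ.tendsto_atTop)
      rw [dist_comm]
      exact (hxy (φ n)).le
    exact (tendsto_iff_of_dist h0).1 hlim

/-- A separable subset of a metric space has a countable family of open sets of the ambient space
that contains arbitrarily small neighbourhoods of each of its points. -/
theorem exists_countable_basis_on {S : Set X} (hS : TopologicalSpace.IsSeparable S) :
    ∃ C : Set (Set X), C.Countable ∧ (∀ W ∈ C, IsOpen W) ∧
      ∀ x ∈ S, ∀ ε > 0, ∃ W ∈ C, x ∈ W ∧ W ⊆ Metric.ball x ε := by
  obtain ⟨c, hc, hSc⟩ := hS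
  refine ⟨⋃ d ∈ c, range fun k : ℕ => Metric.ball d (1 / ((k : ℝ) + 1)),
    hc.biUnion fun _ _ => countable_range _, ?_, ?_⟩
  · intro W hW
    simp only [mem_iUnion, mem_range] at hW
    obtain ⟨d, -, k, rfl⟩ := hW
    exact Metric.isOpen_ball
  · intro x hx ε hε
    obtain ⟨k, hk⟩ := exists_nat_one_div_lt (half_pos hε)
    obtain ⟨d, hd, hxd⟩ := Metric.mem_closure_iff.1 (hSc hx) (1 / ((k : ℝ) + 1))
      Nat.one_div_pos_of_nat
    refine ⟨Metric.ball d (1 / ((k : ℝ) + 1)), ?_, hxd, ?_⟩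
    · simp only [mem_iUnion, mem_range]
      exact ⟨d, hd, k, rfl⟩
    · exact Metric.ball_subset_ball' (by rw [dist_comm d x]; linarith)

theorem acut_of_pos {u : X → ℝ} {α : ℝ} (hα : 0 < α) : acut u α = {x | α ≤ u x} :=
  if_neg hα.ne'

/-- A function with compact cuts at positive levels, attaining the value `1`, lies in
`F¹_USCG(X)`. -/
theorem FUSCG_of_isCompact {v : X → ℝ} (hv : ∀ x, v x ∈ Icc (0 : ℝ) 1) (h1 : ∃ x, 1 ≤ v x)
    (hc : ∀ α ∈ Ioc (0 : ℝ) 1, IsCompact {x | α ≤ v x}) : FUSCG v := by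
  obtain ⟨x, hx⟩ := h1
  refine ⟨⟨hv, fun α hα => ?_⟩, fun α hα => ?_⟩
  · rcases hα.1.eq_or_lt with rfl | h0
    · rw [acut, if_pos rfl]
      exact ⟨⟨x, subset_closure (zero_lt_one.trans_le hx)⟩, isClosed_closure⟩
    · rw [acut_of_pos h0]
      exact ⟨⟨x, hα.2.trans hx⟩, (hc α ⟨h0, hα.2⟩).isClosed⟩
  · rw [acut_of_pos hα.1]
    exact hc α hα

/-- For a sequence of `[0,1]`-valued functions and a countable family `C` of sets, the suprema over
the members of `C` converge simultaneously along a subsequence. -/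
theorem exists_subseq_sSup_tendsto {Y : Type*} {C : Set (Set Y)} (hC : C.Countable) {s : ℕ → Y → ℝ}
    (hs : ∀ n x, s n x ∈ Icc (0 : ℝ) 1) :
    ∃ φ : ℕ → ℕ, StrictMono φ ∧ ∃ h : Set Y → ℝ, ∀ W ∈ C, h W ∈ Icc (0 : ℝ) 1 ∧
      Tendsto (fun n => sSup (s (φ n) '' W)) atTop (𝓝 (h W)) := by
  have : Countable C := hC.to_subtype
  have hmem : ∀ n (W : Set Y), sSup (s n '' W) ∈ Icc (0 : ℝ) 1 := fun n W =>
    ⟨Real.sSup_nonneg (by rintro _ ⟨x, -, rfl⟩; exact (hs n x).1),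
      Real.sSup_le (by rintro _ ⟨x, -, rfl⟩; exact (hs n x).2) zero_le_one⟩
  obtain ⟨g, φ, hφ, hg⟩ := CompactSpace.tendsto_subseq
    (fun n => fun W : C => (⟨sSup (s n '' (W : Set Y)), hmem n W⟩ : Icc (0 : ℝ) 1))
  rw [tendsto_pi_nhds] at hg
  classical
  refine ⟨φ, hφ, fun W => if hW : W ∈ C then (g ⟨W, hW⟩ : ℝ) else 0, fun W hW => ?_⟩
  simp only [hW, dif_pos]
  exact ⟨(g ⟨W, hW⟩).2, (continuous_subtype_val.tendsto _).comp (hg ⟨W, hW⟩)⟩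

/-- Sequences of fuzzy sets whose positive cuts lie in common compact sets have
`H_end`-convergent subsequences. -/
theorem exists_subseq_tendsto_Hend {s : ℕ → X → ℝ} {K : ℝ → Set X}
    (hs : ∀ n x, s n x ∈ Icc (0 : ℝ) 1) (h1 : ∀ n, ∃ x, 1 ≤ s n x)
    (hK : ∀ α ∈ Ioc (0 : ℝ) 1, IsCompact (K α))
    (hsK : ∀ α ∈ Ioc (0 : ℝ) 1, ∀ n x, α ≤ s n x → x ∈ K α) :
    ∃ φ : ℕ → ℕ, StrictMono φ ∧ ∃ v : X → ℝ, FUSCG v ∧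
      Tendsto (fun k => Hend (s (φ k)) v) atTop (𝓝 0) := by
  set S : Set X := ⋃ q : {q : ℚ // (q : ℝ) ∈ Ioc (0 : ℝ) 1}, K q
  have hsep : TopologicalSpace.IsSeparable S :=
    TopologicalSpace.IsSeparable.iUnion fun q => (hK _ q.2).isSeparable
  obtain ⟨C, hCc, hCo, hCb⟩ := exists_countable_basis_on hsep
  obtain ⟨φ, hφ, h, hh⟩ := exists_subseq_sSup_tendsto hCc hs
  set T : X → Set ℝ := fun x =>
    insert 0 {t | t ∈ Icc (0 : ℝ) 1 ∧ x ∈ S ∧ ∀ W ∈ C, x ∈ W → t ≤ h W}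
  set v : X → ℝ := fun x => sSup (T x)
  have hT01 : ∀ x, ∀ t ∈ T x, t ∈ Icc (0 : ℝ) 1 := by
    rintro x t (rfl | ht)
    · simp
    · exact ht.1
  have hbdd : ∀ x, BddAbove (T x) := fun x => ⟨1, fun t ht => (hT01 x t ht).2⟩
  have hne : ∀ x, (T x).Nonempty := fun x => ⟨0, mem_insert _ _⟩
  have hv01 : ∀ x, v x ∈ Icc (0 : ℝ) 1 := fun x =>
    ⟨le_csSup (hbdd x) (mem_insert _ _), csSup_le (hne x) fun t ht => (hT01 x t ht).2⟩
  have hle : ∀ x t, t ∈ Icc (0 : ℝ) 1 → x ∈ S → (∀ W ∈ C, x ∈ W → t ≤ h W) → t ≤ v x :=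
    fun x t ht hx hW => le_csSup (hbdd x) (mem_insert_of_mem _ ⟨ht, hx, hW⟩)
  have hvh : ∀ x, ∀ W ∈ C, x ∈ W → v x ≤ h W := by
    intro x W hW hxW
    refine csSup_le (hne x) ?_
    rintro t (rfl | ht)
    · exact (hh W hW).1.1
    · exact ht.2.2 W hW hxW
  have hvS : ∀ x, 0 < v x → x ∈ S := by
    intro x hx
    by_contra hxS
    refine hx.not_ge (csSup_le (hne x) ?_)
    rintro t (rfl | ht)
    · exact le_rfl
    · exact absurd ht.2.1 hxS
  have hsW : ∀ n x W, x ∈ W → s n x ≤ sSup (s n '' W) := fun n x W hx =>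
    le_csSup ⟨1, by rintro _ ⟨y, -, rfl⟩; exact (hs n y).2⟩ (mem_image_of_mem _ hx)
  have hrat : ∀ α ∈ Ioc (0 : ℝ) 1, ∃ q, q ∈ Ioc (0 : ℝ) 1 ∧ q < α ∧ K q ⊆ S := by
    intro α hα
    obtain ⟨q, hq0, hq1⟩ := exists_rat_btwn hα.1
    have hq : (q : ℝ) ∈ Ioc (0 : ℝ) 1 := ⟨hq0, hq1.le.trans hα.2⟩
    exact ⟨q, hq, hq1, subset_iUnion (fun q : {q : ℚ // (q : ℝ) ∈ Ioc (0 : ℝ) 1} => K q) ⟨q, hq⟩⟩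
  have hcut : ∀ q ∈ Ioc (0 : ℝ) 1, ∀ x, q < v x → x ∈ K q := by
    intro q hq x hx
    by_contra hxK
    obtain ⟨ε, hε, hball⟩ := Metric.isOpen_iff.1 (hK q hq).isClosed.isOpen_compl x hxK
    obtain ⟨W, hW, hxW, hWb⟩ := hCb x (hvS x (hq.1.trans hx)) ε hε
    have : h W ≤ q := le_of_tendsto' (hh W hW).2 fun n => Real.sSup_le (by
      rintro _ ⟨y, hy, rfl⟩
      by_contra! hlt
      exact hball (hWb hy) (hsK q hq _ y hlt.le)) hq.1.le
    exact (this.trans_lt hx).not_ge (hvh x W hW hxW)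
  have hlim : ∀ (ψ : ℕ → ℕ) (y : ℕ → X) (r : ℕ → ℝ) (x : X) (t : ℝ), StrictMono ψ →
      (∀ k, r k ≤ s (φ (ψ k)) (y k)) → Tendsto y atTop (𝓝 x) → Tendsto r atTop (𝓝 t) →
      t ∈ Icc (0 : ℝ) 1 → x ∈ S → t ≤ v x := by
    intro ψ y r x t hψ hr hy hrt ht hx
    refine hle x t ht hx fun W hW hxW => ?_
    refine le_of_tendsto_of_tendsto hrt ((hh W hW).2.comp hψ.tendsto_atTop) ?_
    filter_upwards [hy.eventually ((hCo W hW).mem_nhds hxW)] with k hk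
    exact (hr k).trans (hsW _ _ _ hk)
  have hv1 : ∃ x, 1 ≤ v x := by
    obtain ⟨q, hq, -, hqS⟩ := hrat 1 ⟨zero_lt_one, le_rfl⟩
    choose y hy using fun n => h1 (φ n)
    obtain ⟨x, hx, ψ, hψ, hyx⟩ := (hK q hq).tendsto_subseq (x := y)
      fun n => hsK q hq _ _ (hq.2.trans (hy n))
    exact ⟨x, hlim ψ _ (fun _ => 1) x 1 hψ (fun k => hy _) hyx tendsto_const_nhds
      ⟨zero_le_one, le_rfl⟩ (hqS hx)⟩
  have hvG : FUSCG v := by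
    refine FUSCG_of_isCompact hv01 hv1 fun α hα => ?_
    obtain ⟨q, hq, hqα, hqS⟩ := hrat α hα
    have hsub : {x | α ≤ v x} ⊆ K q := fun x hx => hcut q hq x (hqα.trans_le hx)
    refine (hK q hq).of_isClosed_subset (IsSeqClosed.isClosed ?_) hsub
    intro y x hy hyx
    have hxK : x ∈ K q := (hK q hq).isClosed.mem_of_tendsto hyx
      (Eventually.of_forall fun n => hsub (hy n))
    refine hle x α ⟨hα.1.le, hα.2⟩ (hqS hxK) fun W hW hxW => ?_
    obtain ⟨n, hn⟩ := (hyx.eventually ((hCo W hW).mem_nhds hxW)).exists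
    exact (hy n).trans (hvh _ W hW hn)
  have hupper : ∀ ε ∈ Ioc (0 : ℝ) 1, ∀ᶠ k in atTop, ∀ x t, ε ≤ t → t ≤ 1 → t ≤ s (φ k) x →
      ∃ y, dist x y ≤ ε ∧ t - ε ≤ v y := by
    intro ε hε
    by_contra hcon
    obtain ⟨ψ, hψ, hbad⟩ := extraction_of_frequently_atTop (not_eventually.1 hcon)
    push Not at hbad
    choose x t hεt ht1 hts hfar using hbad
    obtain ⟨q, hq, hqε, hqS⟩ := hrat ε hε
    obtain ⟨⟨a, b⟩, ⟨ha, hb⟩, χ, hχ, hab⟩ := ((hK q hq).prod (isCompact_Icc (a := ε) (b := 1)))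
      |>.tendsto_subseq (x := fun k => (x k, t k))
      fun k => ⟨hsK q hq _ _ (hqε.le.trans ((hεt k).trans (hts k))), hεt k, ht1 k⟩
    rw [nhds_prod_eq, tendsto_prod_iff'] at hab
    obtain ⟨hxa, htb⟩ := hab
    have hbv : b ≤ v a := hlim (ψ ∘ χ) _ _ a b (hψ.comp hχ) (fun k => hts (χ k)) hxa htb
      ⟨hε.1.le.trans hb.1, hb.2⟩ (hqS ha)
    obtain ⟨k, hk1, hk2⟩ := ((Metric.tendsto_nhds.1 hxa ε hε.1).and
      (htb.eventually (eventually_lt_nhds (show b < b + ε by linarith [hε.1])))).exists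
    have hfk := hfar (χ k) a hk1.le
    simp only [Function.comp] at hk2
    linarith
  have hlower : ∀ ε ∈ Ioc (0 : ℝ) 1, ∀ᶠ k in atTop, ∀ x t, ε ≤ t → t ≤ 1 → t ≤ v x →
      ∃ y, dist x y ≤ ε ∧ t - ε ≤ s (φ k) y := by
    intro ε hε
    by_contra hcon
    obtain ⟨ψ, hψ, hbad⟩ := extraction_of_frequently_atTop (not_eventually.1 hcon)
    push Not at hbad
    choose x t hεt ht1 htv hfar using hbad
    obtain ⟨q, hq, hqε, hqS⟩ := hrat ε hε
    obtain ⟨⟨a, b⟩, ⟨ha, hb⟩, χ, hχ, hab⟩ := ((hK q hq).prod (isCompact_Icc (a := ε) (b := 1)))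
      |>.tendsto_subseq (x := fun k => (x k, t k))
      fun k => ⟨hcut q hq _ (hqε.trans_le ((hεt k).trans (htv k))), hεt k, ht1 k⟩
    rw [nhds_prod_eq, tendsto_prod_iff'] at hab
    obtain ⟨hxa, htb⟩ := hab
    obtain ⟨W, hW, haW, hWb⟩ := hCb a (hqS ha) (ε / 2) (half_pos hε.1)
    have hbW : b ≤ h W := by
      refine le_of_tendsto htb ?_
      filter_upwards [hxa.eventually ((hCo W hW).mem_nhds haW)] with k hk
      exact (htv _).trans (hvh _ W hW hk)
    have hsup : ∀ᶠ k in atTop, b - ε / 2 < sSup (s (φ (ψ (χ k))) '' W) :=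
      ((hh W hW).2.comp (hψ.comp hχ).tendsto_atTop).eventually
        (lt_mem_nhds (show b - ε / 2 < h W by linarith [hε.1]))
    obtain ⟨k, hk1, hk2, hk3⟩ := ((Metric.tendsto_nhds.1 hxa (ε / 2) (half_pos hε.1)).and
      ((htb.eventually (eventually_lt_nhds (show b < b + ε / 2 by linarith [hε.1]))).and
        hsup)).exists
    simp only [Function.comp] at hk1 hk2
    refine hk3.not_ge (Real.sSup_le ?_ (by linarith [hε.1, hb.1]))
    rintro _ ⟨y, hy, rfl⟩
    have hya := Metric.mem_ball.1 (hWb hy)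
    have hfk := hfar (χ k) y (by linarith [dist_triangle_right (x (χ k)) y a])
    linarith
  refine ⟨φ, hφ, v, hvG, ?_⟩
  rw [ENNReal.tendsto_nhds_zero]
  intro δ hδ
  obtain ⟨ε, hε, hεδ⟩ : ∃ ε ∈ Ioc (0 : ℝ) 1, ENNReal.ofReal (2 * ε) ≤ δ := by
    obtain ⟨r, hr0, hrδ⟩ := ENNReal.lt_iff_exists_nnreal_btwn.1 hδ
    have hr : (0 : ℝ) < r := by exact_mod_cast hr0
    refine ⟨min (r / 2) 1, ⟨lt_min (half_pos hr) zero_lt_one, min_le_right _ _⟩, ?_⟩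
    refine le_trans ?_ hrδ.le
    rw [← ENNReal.ofReal_coe_nnreal]
    exact ENNReal.ofReal_le_ofReal (by linarith [min_le_left ((r : ℝ) / 2) 1])
  filter_upwards [hupper ε hε, hlower ε hε] with k hku hkl
  exact (max_le (HPstar_endograph_le hε.1 (fun x => (hv01 x).1) hku)
    (HPstar_endograph_le hε.1 (fun x => (hs _ x).1) hkl)).trans hεδ

/-- If every sequence in `U` has an `H_end`-convergent subsequence, then the unions of the positive
cuts are relatively compact. -/
theorem isCompact_closure_iUnion_acut {U : Set (X → ℝ)}
    (hU : ∀ s : ℕ → X → ℝ, (∀ n, s n ∈ U) →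
      ∃ φ : ℕ → ℕ, StrictMono φ ∧ ∃ v : X → ℝ, FUSCG v ∧
        Tendsto (fun k => Hend (s (φ k)) v) atTop (𝓝 0)) {α : ℝ} (hα : α ∈ Ioc (0 : ℝ) 1) :
    IsCompact (closure (⋃ u ∈ U, acut u α)) := by
  refine isCompact_closure_of_tendsto_subseq fun x hx => ?_
  simp only [mem_iUnion, acut_of_pos hα.1, mem_ofPred_eq, exists_prop] at hx
  choose s hsU hsx using hx
  obtain ⟨φ, hφ, v, hv, hlim⟩ := hU s hsU
  have hnear : ∀ m : ℕ, ∀ᶠ k in atTop,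
      ∃ y, dist (x (φ k)) y < α / 2 * (1 / ((m : ℝ) + 1)) ∧ α / 2 ≤ v y := by
    intro m
    have hm : (0 : ℝ) < 1 / ((m : ℝ) + 1) := Nat.one_div_pos_of_nat
    have hm1 : 1 / ((m : ℝ) + 1) ≤ 1 := by
      rw [div_le_one (by positivity)]; linarith [m.cast_nonneg (α := ℝ)]
    have hpos : 0 < α / 2 * (1 / ((m : ℝ) + 1)) := mul_pos (half_pos hα.1) hm
    filter_upwards [hlim.eventually (gt_mem_nhds (ENNReal.ofReal_pos.2 hpos))] with k hk
    obtain ⟨y, hy, hyv⟩ := exists_near_of_Hend_lt hk hα.1.le hα.2 (hsx (φ k))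
    exact ⟨y, hy, by nlinarith [hα.1]⟩
  obtain ⟨ψ, hψ, hex⟩ := extraction_forall_of_eventually hnear
  choose y hxy hyv using hex
  have hα2 : α / 2 ∈ Ioc (0 : ℝ) 1 := ⟨half_pos hα.1, by linarith [hα.1, hα.2]⟩
  obtain ⟨a, -, χ, hχ, hya⟩ := (hv.2 _ hα2).tendsto_subseq (x := y)
    fun n => by rw [acut_of_pos hα2.1]; exact hyv n
  refine ⟨a, φ ∘ ψ ∘ χ, hφ.comp (hψ.comp hχ), ?_⟩
  have h0 : Tendsto (fun n => dist ((y ∘ χ) n) ((x ∘ φ ∘ ψ ∘ χ) n)) atTop (𝓝 0) := by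
    refine squeeze_zero (fun _ => dist_nonneg) (fun n => ?_) (by
      simpa using (tendsto_one_div_add_atTop_nhds_zero_nat.const_mul (α / 2)).comp
        hχ.tendsto_atTop)
    rw [dist_comm]
    simpa using (hxy (χ n)).le
  exact (tendsto_iff_of_dist h0).1 hya

/-- `U ⊆ F¹_USCG(X)` is relatively compact in `(F¹_USCG(X), H_end)` (i.e.
every sequence in `U` has a subsequence `H_end`-converging to some element of
`F¹_USCG(X)`) iff each `U(α)`, `α ∈ (0,1]`, is relatively compact in `X`. -/
theorem stmt17 (U : Set (X → ℝ)) (hU : ∀ u ∈ U, FUSCG u) :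
    (∀ s : ℕ → X → ℝ, (∀ n, s n ∈ U) →
        ∃ φ : ℕ → ℕ, StrictMono φ ∧ ∃ v : X → ℝ, FUSCG v ∧
          Tendsto (fun k => Hend (s (φ k)) v) atTop (𝓝 0)) ↔
      ∀ α ∈ Ioc (0:ℝ) 1, IsCompact (closure (⋃ u ∈ U, acut u α)) := by
  refine ⟨fun h α hα => isCompact_closure_iUnion_acut h hα, fun hK s hs => ?_⟩
  refine exists_subseq_tendsto_Hend (fun n => (hU _ (hs n)).1.1) (fun n => ?_) hK ?_
  · obtain ⟨x, hx⟩ := ((hU _ (hs n)).1.2 1 ⟨zero_le_one, le_rfl⟩).1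
    rw [acut_of_pos zero_lt_one] at hx
    exact ⟨x, hx⟩
  · intro α hα n x hx
    refine subset_closure (mem_iUnion₂.2 ⟨s n, hs n, ?_⟩)
    rwa [acut_of_pos hα.1]

end
end

section
/- Let (X,d) be a metric space and let U ⊆ F¹_USCB(X). Then U is totally bounded in (F¹_USCB(X), H_send) if and only if U(0) = ∪_{u∈U} [u]_0 is totally bounded in (X,d). -/
open Set Filter Topology MeasureTheory
open scoped ENNReal NNReal

noncomputable section

variable {X : Type*} [MetricSpace X]

lemma hStar_le_of_forall_exists {Y : Type*} {ρ : Y → Y → ℝ≥0∞} {A B : Set Y} {r : ℝ≥0∞}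
    (h : ∀ a ∈ A, ∃ b ∈ B, ρ a b ≤ r) : hStar ρ A B ≤ r :=
  iSup₂_le fun a ha => let ⟨b, hb, hab⟩ := h a ha; iInf₂_le_of_le b hb hab

lemma exists_lt_of_hStar_lt {Y : Type*} {ρ : Y → Y → ℝ≥0∞} {A B : Set Y} {r : ℝ≥0∞}
    (h : hStar ρ A B < r) {a : Y} (ha : a ∈ A) : ∃ b ∈ B, ρ a b < r := by
  have := (le_iSup₂ (f := fun a _ => ⨅ b ∈ B, ρ a b) a ha).trans_lt h
  simpa only [iInf_lt_iff, exists_prop] using this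

/-- If every point of `A` is coordinatewise within `δ` of a point of `T`, and `B` has a point
within `δ` of every point of `T` that is near `A`, then `H*(A,B) ≤ 4δ`. -/
lemma HPstar_le_of_near {A B T : Set (X × ℝ)} {δ : ℝ≥0∞}
    (hA : ∀ a ∈ A, ∃ p ∈ T, edist a.1 p.1 < δ ∧ edist a.2 p.2 < δ)
    (hAB : ∀ p ∈ T, (∃ a ∈ A, edist a.1 p.1 < δ ∧ edist a.2 p.2 < δ) →
      ∃ b ∈ B, edist b.1 p.1 < δ ∧ edist b.2 p.2 < δ) :
    HPstar A B ≤ δ + δ + (δ + δ) := by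
  refine hStar_le_of_forall_exists fun a ha => ?_
  obtain ⟨p, hp, h1, h2⟩ := hA a ha
  obtain ⟨b, hb, h3, h4⟩ := hAB p hp ⟨a, ha, h1, h2⟩
  exact ⟨b, hb, add_le_add
    ((edist_triangle_right _ _ _).trans (add_le_add h1.le h3.le))
    ((edist_triangle_right _ _ _).trans (add_le_add h2.le h4.le))⟩

lemma exists_finite_approx_of_totallyBounded {U : Set (X → ℝ)}
    (h : TotallyBounded (⋃ u ∈ U, acut u 0)) {ε : ℝ≥0∞} (hε : 0 < ε) :
    ∃ V ⊆ U, V.Finite ∧ ∀ u ∈ U, ∃ v ∈ V, Hsend u v < ε := by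
  obtain ⟨r, hr, hrε⟩ := exists_between hε
  set δ := r / 2 / 2 with hδ
  have hδ0 : 0 < δ := ENNReal.half_pos (ENNReal.half_pos hr.ne').ne'
  have hδr : δ + δ + (δ + δ) = r := by rw [hδ, ENNReal.add_halves, ENNReal.add_halves]
  obtain ⟨S, hS, hUS⟩ := EMetric.totallyBounded_iff.1 h δ hδ0
  obtain ⟨R, hR, hIR⟩ := EMetric.totallyBounded_iff.1 (totallyBounded_Icc (0 : ℝ) 1) δ hδ0
  have hnear : ∀ u ∈ U, ∀ a ∈ sendograph u,
      ∃ p ∈ S ×ˢ R, edist a.1 p.1 < δ ∧ edist a.2 p.2 < δ := by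
    rintro u hu a ⟨-, ha0, ha1⟩
    obtain ⟨x, hx, hax⟩ := mem_iUnion₂.1 (hUS (mem_biUnion hu ha0))
    obtain ⟨t, ht, hat⟩ := mem_iUnion₂.1 (hIR ha1)
    exact ⟨(x, t), ⟨hx, ht⟩, hax, hat⟩
  let σ : (X → ℝ) → Set (X × ℝ) := fun u =>
    {p ∈ S ×ˢ R | ∃ a ∈ sendograph u, edist a.1 p.1 < δ ∧ edist a.2 p.2 < δ}
  have hσ : (σ '' U).Finite :=
    (hS.prod hR).finite_subsets.subset (image_subset_iff.2 fun u _ => sep_subset _ _)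
  obtain ⟨V, hVU, hV⟩ := exists_subset_bijOn U σ
  refine ⟨V, hVU, hV.finite_iff_finite.2 hσ, fun u hu => ?_⟩
  obtain ⟨v, hv, hvu⟩ := hV.surjOn (mem_image_of_mem σ hu)
  have hle : ∀ {f g : X → ℝ}, f ∈ U → σ f = σ g →
      HPstar (sendograph f) (sendograph g) ≤ r := fun hf hfg =>
    hδr ▸ HPstar_le_of_near (hnear _ hf) fun p hp hpf => (hfg.subset ⟨hp, hpf⟩).2
  exact ⟨v, hv, (max_le (hle hu hvu.symm) (hle (hVU hv) hvu)).trans_lt hrε⟩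

lemma exists_edist_lt_of_Hsend_lt {u v : X → ℝ} (hu : FUSC u) {ε : ℝ≥0∞}
    (h : Hsend u v < ε) {x : X} (hx : x ∈ acut u 0) : ∃ y ∈ acut v 0, edist x y < ε := by
  have h0 : (0 : ℝ) ∈ Icc (0 : ℝ) 1 := ⟨le_rfl, zero_le_one⟩
  have hmem : (x, (0 : ℝ)) ∈ sendograph u := ⟨⟨h0, (hu.1 x).1⟩, hx, h0⟩
  obtain ⟨b, hb, hxb⟩ := exists_lt_of_hStar_lt ((le_max_left _ _).trans_lt h) hmem
  exact ⟨b.1, hb.2.1, le_self_add.trans_lt hxb⟩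

/-- `U ⊆ F¹_USCB(X)` is totally bounded in `(F¹_USCB(X), H_send)` (i.e. for
every `ε > 0` it has a finite `ε`-approximation) iff `U(0)` is totally bounded in `X`. -/
theorem stmt18 (U : Set (X → ℝ)) (hU : ∀ u ∈ U, FUSCB u) :
    (∀ ε : ℝ≥0∞, 0 < ε → ∃ V ⊆ U, V.Finite ∧ ∀ u ∈ U, ∃ v ∈ V, Hsend u v < ε) ↔
      TotallyBounded (⋃ u ∈ U, acut u 0) := by
  refine ⟨fun h => EMetric.totallyBounded_iff.2 fun ε hε => ?_,
    fun h ε hε => exists_finite_approx_of_totallyBounded h hε⟩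
  obtain ⟨V, hVU, hVfin, hV⟩ := h (ε / 2) (ENNReal.half_pos hε.ne')
  have hcomp : IsCompact (⋃ v ∈ V, acut v 0) :=
    hVfin.isCompact_biUnion fun v hv => (hU v (hVU hv)).2
  obtain ⟨t, ht, hVt⟩ :=
    EMetric.totallyBounded_iff.1 hcomp.totallyBounded (ε / 2) (ENNReal.half_pos hε.ne')
  refine ⟨t, ht, iUnion₂_subset fun u hu x hx => ?_⟩
  obtain ⟨v, hv, huv⟩ := hV u hu
  obtain ⟨y, hy, hxy⟩ := exists_edist_lt_of_Hsend_lt (hU u hu).1 huv hx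
  obtain ⟨z, hz, hyz⟩ := mem_iUnion₂.1 (hVt (mem_biUnion hv hy))
  refine mem_iUnion₂.2 ⟨z, hz, ?_⟩
  calc edist x z ≤ edist x y + edist y z := edist_triangle _ _ _
    _ < ε / 2 + ε / 2 := ENNReal.add_lt_add hxy hyz
    _ = ε := ENNReal.add_halves ε

end
end
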